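/- arXiv:2109.10216 — 6 statements merged into one kernel-verified Lean document; each statement's English description precedes it below -/
import Mathlib

section
/- Let a, b, c be linearly independent unit vectors in ℝ³ with ⟪a,b⟫ · ⟪a,c⟫ · ⟪b,c⟫ ≤ 0 (a big triangle), and let p be a unit vector that is a minimizer for (a,b,c) satisfying ⟪a,p⟫ ≥ 0, ⟪b,p⟫ ≥ 0, ⟪c,p⟫ ≥ 0, ⟪a,p⟫ ≥ ⟪b,p⟫ and ⟪a,p⟫ ≥ ⟪c,p⟫. Then there exist signs ε_b, ε_c ∈ {1, -1} such that the replaced vectors b' = ε_b • b and c' = ε_c • c still satisfy ⟪b',p⟫ ≥ 0, ⟪c',p⟫ ≥ 0, ⟪a,p⟫ ≥ ⟪b',p⟫, ⟪a,p⟫ ≥ ⟪c',p⟫, and additionally ⟪b',c'⟫ ≤ 0. -/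
open RealInnerProductSpace

noncomputable def dS (x y : EuclideanSpace ℝ (Fin 3)) : ℝ := Real.sqrt (1 - ⟪x, y⟫ ^ 2)

noncomputable def J (a b c p : EuclideanSpace ℝ (Fin 3)) : ℝ := dS a p + dS b p + dS c p

def IsMinimizer (a b c p : EuclideanSpace ℝ (Fin 3)) : Prop :=
  ‖p‖ = 1 ∧ ∀ q : EuclideanSpace ℝ (Fin 3), ‖q‖ = 1 → J a b c p ≤ J a b c q

theorem aux_cs (c2 c3 p2 p3 X Y : ℝ) (hX : 0 ≤ X) (hY : 0 ≤ Y)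
    (eX : X ^ 2 = c2 ^ 2 + c3 ^ 2) (eY : Y ^ 2 = p2 ^ 2 + p3 ^ 2) :
    c2 * p2 + c3 * p3 ≤ X * Y := by
  refine (abs_le_of_sq_le_sq' ?_ (mul_nonneg hX hY)).2
  rw [mul_pow, eX, eY]; nlinarith [sq_nonneg (c2 * p3 - c3 * p2)]

theorem aux_k1 (p1 c1 c2 c3 p2 p3 X Y : ℝ) (hX : 0 ≤ X) (hY : 0 ≤ Y) (h : 0 ≤ p1 * c1)
    (eX : X ^ 2 = c2 ^ 2 + c3 ^ 2) (eY : Y ^ 2 = p2 ^ 2 + p3 ^ 2) :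
    (p1 * c2 + p2 * c1) ^ 2 + (p1 * c3 + p3 * c1) ^ 2 ≤ (p1 * X + c1 * Y) ^ 2 := by
  have k := mul_le_mul_of_nonneg_left (aux_cs c2 c3 p2 p3 X Y hX hY eX eY) h
  linear_combination 2 * k - p1 ^ 2 * eX - c1 ^ 2 * eY

theorem aux_le {x y : ℝ} (h : x ^ 2 ≤ y ^ 2) (hy : 0 ≤ y) : x ≤ y :=
  (abs_le_of_sq_le_sq' h hy).2

theorem aux_core (p1 p2 p3 c1 c2 c3 X1 Y1 X3 Y3 : ℝ)
    (hp2 : 0 ≤ p2) (hc2 : 0 ≤ c2) (hc1 : 0 ≤ c1) (hc3 : 0 ≤ c3) (h1 : c1 < p1) (h3 : c3 < p3)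
    (hp : p1 ^ 2 + p2 ^ 2 + p3 ^ 2 = 1) (hc : c1 ^ 2 + c2 ^ 2 + c3 ^ 2 = 1)
    (hX1 : 0 ≤ X1) (hY1 : 0 ≤ Y1) (hX3 : 0 ≤ X3) (hY3 : 0 ≤ Y3)
    (eX1 : X1 ^ 2 = c2 ^ 2 + c3 ^ 2) (eY1 : Y1 ^ 2 = p2 ^ 2 + p3 ^ 2)
    (eX3 : X3 ^ 2 = c1 ^ 2 + c2 ^ 2) (eY3 : Y3 ^ 2 = p1 ^ 2 + p2 ^ 2)
    (hS : X1 + Y1 ≤ X3 + Y3) :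
    (X1 - Y1 + (X3 - Y3)) ^ 2 < 1 - (p1 * c1 + p2 * c2 + p3 * c3) ^ 2 := by
  have hp1 : 0 < p1 := by linarith
  have hp3 : 0 < p3 := by linarith
  have hXY1 : Y1 < X1 := by
    apply lt_of_pow_lt_pow_left₀ 2 hX1
    nlinarith
  have hXY3 : Y3 < X3 := by
    apply lt_of_pow_lt_pow_left₀ 2 hX3
    nlinarith
  have hS1 : 0 < X1 + Y1 := by linarith
  have hS3 : 0 < X3 + Y3 := by linarith
  set S1 := X1 + Y1 with dS1
  set S3 := X3 + Y3 with dS3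
  set m := p1 * c3 + p3 * c1 with dm
  have hm : 0 ≤ m := by positivity
  set V1 := p1 * c2 - p2 * c1 with dV1
  set V2 := p3 * c2 - p2 * c3 with dV2
  set V3 := p1 * c3 - p3 * c1 with dV3
  set A1 := (p1 * c2 + p2 * c1) / S1 with dA1
  set A2 := (p3 * c2 + p2 * c3) / S3 with dA2
  set A3 := m / S1 - m / S3 with dA3
  have hV : V1 ^ 2 + V2 ^ 2 + V3 ^ 2 = 1 - (p1 * c1 + p2 * c2 + p3 * c3) ^ 2 := by
    have : (1 : ℝ) = (p1 ^ 2 + p2 ^ 2 + p3 ^ 2) * (c1 ^ 2 + c2 ^ 2 + c3 ^ 2) := by rw [hp, hc]; norm_num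
    rw [this, dV1, dV2, dV3]; ring
  have hT1 : X1 - Y1 = (V1 * (p1 * c2 + p2 * c1) + V3 * m) / S1 := by
    rw [eq_div_iff hS1.ne']
    have e1 : (X1 - Y1) * S1 = p1 ^ 2 - c1 ^ 2 := by rw [dS1]; linear_combination eX1 - eY1 + hc - hp
    have e2 : V1 * (p1 * c2 + p2 * c1) + V3 * m
        = p1 ^ 2 * (c1 ^ 2 + c2 ^ 2 + c3 ^ 2) - c1 ^ 2 * (p1 ^ 2 + p2 ^ 2 + p3 ^ 2) := by
      rw [dV1, dV3, dm]; ring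
    rw [e1, e2, hp, hc]; ring
  have hT3 : X3 - Y3 = (V2 * (p3 * c2 + p2 * c3) - V3 * m) / S3 := by
    rw [eq_div_iff hS3.ne']
    have e1 : (X3 - Y3) * S3 = p3 ^ 2 - c3 ^ 2 := by rw [dS3]; linear_combination eX3 - eY3 + hc - hp
    have e2 : V2 * (p3 * c2 + p2 * c3) - V3 * m
        = p3 ^ 2 * (c1 ^ 2 + c2 ^ 2 + c3 ^ 2) - c3 ^ 2 * (p1 ^ 2 + p2 ^ 2 + p3 ^ 2) := by
      rw [dV2, dV3, dm]; ring
    rw [e1, e2, hp, hc]; ring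
  have hT : X1 - Y1 + (X3 - Y3) = V1 * A1 + V2 * A2 + V3 * A3 := by
    rw [hT1, hT3, dA1, dA2, dA3]; ring
  have hA13 : A1 ^ 2 + A3 ^ 2 ≤ p1 ^ 2 := by
    have a3 : A3 ^ 2 ≤ (m / S1) ^ 2 := by
      have u1 : m / S3 ≤ m / S1 := div_le_div_of_nonneg_left hm hS1 hS
      have u2 : 0 ≤ m / S3 := by positivity
      apply pow_le_pow_left₀ <;> rw [dA3] <;> linarith
    have k : (p1 * c2 + p2 * c1) ^ 2 + m ^ 2 ≤ (p1 * S1) ^ 2 := by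
      have k1 : (p1 * c2 + p2 * c1) ^ 2 + m ^ 2 ≤ (p1 * X1 + c1 * Y1) ^ 2 := by
        exact aux_k1 p1 c1 c2 c3 p2 p3 X1 Y1 hX1 hY1 (by positivity) eX1 eY1
      refine k1.trans (pow_le_pow_left₀ (by positivity) ?_ 2)
      have := mul_le_mul_of_nonneg_right h1.le hY1
      rw [dS1]; linarith
    calc A1 ^ 2 + A3 ^ 2 ≤ A1 ^ 2 + (m / S1) ^ 2 := by linarith
      _ = ((p1 * c2 + p2 * c1) ^ 2 + m ^ 2) / S1 ^ 2 := by rw [dA1, div_pow, div_pow, ← add_div]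
      _ ≤ p1 ^ 2 := by rw [div_le_iff₀ (by positivity)]; linarith [mul_pow p1 S1 2]
  have hA2 : A2 < p3 := by
    rw [dA2, div_lt_iff₀ hS3]
    have u1 : c2 ≤ X3 := by refine aux_le ?_ hX3; rw [eX3]; linarith [sq_nonneg c1]
    have u2 : p2 < Y3 := by
      apply lt_of_pow_lt_pow_left₀ 2 hY3
      rw [eY3]; linarith [pow_pos hp1 2]
    have v1 := mul_le_mul_of_nonneg_left u1 hp3.le
    have v2 := mul_lt_mul_of_pos_left u2 hp3
    have v3 := mul_le_mul_of_nonneg_left h3.le hp2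
    rw [dS3]; linarith
  have hA20 : 0 ≤ A2 := by positivity
  have hA : A1 ^ 2 + A2 ^ 2 + A3 ^ 2 < 1 := by
    have := pow_lt_pow_left₀ hA2 hA20 two_ne_zero
    linarith [sq_nonneg p2]
  have hCS : (V1 * A1 + V2 * A2 + V3 * A3) ^ 2 ≤
      (V1 ^ 2 + V2 ^ 2 + V3 ^ 2) * (A1 ^ 2 + A2 ^ 2 + A3 ^ 2) := by
    linarith [sq_nonneg (V1 * A2 - V2 * A1), sq_nonneg (V1 * A3 - V3 * A1),
      sq_nonneg (V2 * A3 - V3 * A2)]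
  rw [← hV]
  rw [← hT] at hCS
  have hpos : 0 < (X1 - Y1 + (X3 - Y3)) ^ 2 := by
    have : 0 < X1 - Y1 + (X3 - Y3) := by linarith
    positivity
  have hVn : 0 ≤ V1 ^ 2 + V2 ^ 2 + V3 ^ 2 := by positivity
  rcases hVn.eq_or_lt with h | h
  · rw [← h] at hCS; linarith
  · have := mul_lt_mul_of_pos_left hA h
    linarith

theorem aux_real (p1 p2 p3 c1 c2 c3 : ℝ)
    (hp2 : 0 ≤ p2) (hc2 : 0 ≤ c2) (hc1 : 0 ≤ c1) (hc3 : 0 ≤ c3) (h1 : c1 < p1) (h3 : c3 < p3)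
    (hp : p1 ^ 2 + p2 ^ 2 + p3 ^ 2 = 1) (hc : c1 ^ 2 + c2 ^ 2 + c3 ^ 2 = 1) :
    √(1 - c1 ^ 2) + √(1 - c3 ^ 2) < √(1 - p1 ^ 2) + √(1 - p3 ^ 2)
      + √(1 - (p1 * c1 + p2 * c2 + p3 * c3) ^ 2) := by
  have eX1 : √(1 - c1 ^ 2) ^ 2 = c2 ^ 2 + c3 ^ 2 := by rw [Real.sq_sqrt] <;> nlinarith
  have eY1 : √(1 - p1 ^ 2) ^ 2 = p2 ^ 2 + p3 ^ 2 := by rw [Real.sq_sqrt] <;> nlinarith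
  have eX3 : √(1 - c3 ^ 2) ^ 2 = c1 ^ 2 + c2 ^ 2 := by rw [Real.sq_sqrt] <;> nlinarith
  have eY3 : √(1 - p3 ^ 2) ^ 2 = p1 ^ 2 + p2 ^ 2 := by rw [Real.sq_sqrt] <;> nlinarith
  have nX1 := Real.sqrt_nonneg (1 - c1 ^ 2)
  have nY1 := Real.sqrt_nonneg (1 - p1 ^ 2)
  have nX3 := Real.sqrt_nonneg (1 - c3 ^ 2)
  have nY3 := Real.sqrt_nonneg (1 - p3 ^ 2)
  rcases le_total (√(1 - c1 ^ 2) + √(1 - p1 ^ 2)) (√(1 - c3 ^ 2) + √(1 - p3 ^ 2)) with hS | hS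
  · have := aux_core p1 p2 p3 c1 c2 c3 _ _ _ _ hp2 hc2 hc1 hc3 h1 h3 hp hc nX1 nY1 nX3 nY3
      eX1 eY1 eX3 eY3 hS
    have := Real.lt_sqrt_of_sq_lt this
    linarith
  · have := aux_core p3 p2 p1 c3 c2 c1 _ _ _ _ hp2 hc2 hc3 hc1 h3 h1 (by linarith) (by linarith)
      nX3 nY3 nX1 nY1 (by linarith) (by linarith) (by linarith) (by linarith) hS
    have := Real.lt_sqrt_of_sq_lt this
    have e : p3 * c3 + p2 * c2 + p1 * c1 = p1 * c1 + p2 * c2 + p3 * c3 := by ring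
    rw [e] at this
    linarith

theorem aux_sq (x y : EuclideanSpace ℝ (Fin 3)) (hx : ‖x‖ = 1) (hy : ‖y‖ = 1) (t : ℝ) :
    ‖x - t • y‖ ^ 2 = 1 - 2 * t * ⟪x, y⟫ + t ^ 2 := by
  rw [norm_sub_sq_real, inner_smul_right, norm_smul, hx, hy, mul_one, Real.norm_eq_abs, sq_abs]
  ring

theorem dS_eq (x y : EuclideanSpace ℝ (Fin 3)) (hx : ‖x‖ = 1) (hy : ‖y‖ = 1) :
    dS x y = ‖x - ⟪x, y⟫ • y‖ := by
  rw [dS, ← Real.sqrt_sq (norm_nonneg (x - ⟪x, y⟫ • y)), aux_sq x y hx hy]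
  congr 1; ring

theorem dS_le (x y : EuclideanSpace ℝ (Fin 3)) (hx : ‖x‖ = 1) (hy : ‖y‖ = 1) (t : ℝ) :
    dS x y ≤ ‖x - t • y‖ := by
  rw [dS, ← Real.sqrt_sq (norm_nonneg (x - t • y)), aux_sq x y hx hy]
  apply Real.sqrt_le_sqrt
  nlinarith [sq_nonneg (t - ⟪x, y⟫)]

theorem dS_tri (x y z : EuclideanSpace ℝ (Fin 3)) (hx : ‖x‖ = 1) (hy : ‖y‖ = 1) (hz : ‖z‖ = 1)
    (h : 0 ≤ ⟪x, y⟫) : dS x z ≤ dS x y + ⟪x, y⟫ * dS y z := by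
  refine (dS_le x z hx hz (⟪x, y⟫ * ⟪y, z⟫)).trans ?_
  rw [dS_eq x y hx hy, dS_eq y z hy hz]
  have : x - (⟪x, y⟫ * ⟪y, z⟫) • z = (x - ⟪x, y⟫ • y) + ⟪x, y⟫ • (y - ⟪y, z⟫ • z) := by
    module
  rw [this]
  refine (norm_add_le _ _).trans ?_
  rw [norm_smul, Real.norm_of_nonneg h]

theorem dS_comm (x y : EuclideanSpace ℝ (Fin 3)) : dS x y = dS y x := by
  rw [dS, dS, real_inner_comm]

theorem inner_le_one (x y : EuclideanSpace ℝ (Fin 3)) (hx : ‖x‖ = 1) (hy : ‖y‖ = 1) :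
    ⟪x, y⟫ ≤ 1 := by
  have := real_inner_le_norm x y
  rwa [hx, hy, mul_one] at this

theorem aux_b (bc bp ec ep ρ u v : ℝ) (hρ0 : 0 < ρ) (hρ1 : ρ ≤ 1) (hu : 0 ≤ u) (huv : u ≤ v)
    (hbc : 0 < bc) (h2 : bc < bp) (hec : 0 < ec) (h3 : ec < ep) (le1 : ep ≤ 1)
    (e1 : ρ * ec = bc + u) (e2 : ρ * ep = bp + v) :
    √(1 - bc ^ 2) - √(1 - bp ^ 2) ≤ √(1 - ec ^ 2) - √(1 - ep ^ 2) := by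
  have q1 : bc ≤ ec := by nlinarith
  have q2 : bp ≤ ep := by nlinarith
  have q3 : bp - bc ≤ ep - ec := by nlinarith
  have g1 : bc ^ 2 ≤ ec ^ 2 := pow_le_pow_left₀ hbc.le q1 2
  have g2 : bp ^ 2 ≤ ep ^ 2 := pow_le_pow_left₀ (by linarith) q2 2
  have g3 : ec ^ 2 < ep ^ 2 := pow_lt_pow_left₀ h3 hec.le two_ne_zero
  have g4 : ep ^ 2 ≤ 1 := pow_le_one₀ (by linarith) le1
  have s1 : √(1 - ec ^ 2) ^ 2 = 1 - ec ^ 2 := Real.sq_sqrt (by linarith)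
  have s2 : √(1 - ep ^ 2) ^ 2 = 1 - ep ^ 2 := Real.sq_sqrt (by linarith)
  have s3 : √(1 - bc ^ 2) ^ 2 = 1 - bc ^ 2 := Real.sq_sqrt (by linarith)
  have s4 : √(1 - bp ^ 2) ^ 2 = 1 - bp ^ 2 := Real.sq_sqrt (by linarith)
  have m1 : √(1 - ec ^ 2) ≤ √(1 - bc ^ 2) := Real.sqrt_le_sqrt (by linarith)
  have m2 : √(1 - ep ^ 2) ≤ √(1 - bp ^ 2) := Real.sqrt_le_sqrt (by linarith)
  have m3 : √(1 - ep ^ 2) < √(1 - ec ^ 2) := Real.sqrt_lt_sqrt (by linarith) (by linarith)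
  have n2 := Real.sqrt_nonneg (1 - ep ^ 2)
  by_contra hcon
  push Not at hcon
  have w1 := mul_lt_mul hcon (add_le_add m1 m2) (by linarith) (by linarith)
  have w2 : (bp - bc) * (bp + bc) ≤ (ep - ec) * (ep + ec) :=
    mul_le_mul q3 (by linarith) (by linarith) (by linarith)
  linarith

theorem aux_case3 (a b c p : EuclideanSpace ℝ (Fin 3))
    (ha : ‖a‖ = 1) (hb : ‖b‖ = 1) (hc : ‖c‖ = 1) (hp : ‖p‖ = 1)
    (hab : ⟪a, b⟫ ≤ 0) (hac : 0 ≤ ⟪a, c⟫) (hbc : 0 < ⟪b, c⟫)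
    (hcp : 0 < ⟪c, p⟫) (h1 : ⟪a, c⟫ < ⟪a, p⟫) (h2 : ⟪b, c⟫ < ⟪b, p⟫) :
    dS a c + dS b c < dS a p + dS b p + dS c p := by
  set τ := -⟪a, b⟫ with hτ
  have hτ0 : 0 ≤ τ := by linarith
  set b0 := b + τ • a with hb0
  have hb0sq : ‖b0‖ ^ 2 = 1 - τ ^ 2 := by
    rw [hb0, norm_add_sq_real, inner_smul_right, norm_smul, ha, hb, real_inner_comm, mul_one,
      Real.norm_eq_abs, sq_abs]
    linarith [show ⟪a, b⟫ = -τ by simp [hτ], congrArg (fun t => τ * t) (show ⟪a, b⟫ = -τ by simp [hτ])]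
  set ρ := ‖b0‖ with hρ
  have hi : ∀ x, ⟪b0, x⟫ = ⟪b, x⟫ + τ * ⟪a, x⟫ := by
    intro x; rw [hb0, inner_add_left, real_inner_smul_left]
  have hρ0 : 0 < ρ := by
    rcases (norm_nonneg b0).eq_or_lt with h | h
    · exfalso
      have : b0 = 0 := norm_eq_zero.mp h.symm
      have h3 := hi p
      rw [this, inner_zero_left] at h3
      have : 0 ≤ τ * ⟪a, p⟫ := mul_nonneg hτ0 (by linarith)
      linarith
    · exact h
  have hρ1 : ρ ≤ 1 := by nlinarith
  set e := ρ⁻¹ • b0 with he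
  have hen : ‖e‖ = 1 := by
    rw [he, norm_smul, norm_inv, Real.norm_of_nonneg hρ0.le, ← hρ, inv_mul_cancel₀ hρ0.ne']
  have hie : ∀ x, ρ * ⟪e, x⟫ = ⟪b, x⟫ + τ * ⟪a, x⟫ := by
    intro x; rw [he, real_inner_smul_left, ← mul_assoc, mul_inv_cancel₀ hρ0.ne', one_mul, hi]
  have hae : ⟪a, e⟫ = 0 := by
    have h3 := hie a
    rw [real_inner_self_eq_norm_sq, ha, real_inner_comm a b] at h3
    have h4 : ρ * ⟪e, a⟫ = 0 := by rw [h3, hτ]; ring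
    rw [real_inner_comm]
    exact (mul_eq_zero.mp h4).resolve_left hρ0.ne'
  have hsplit : ∀ x y, ⟪x - ⟪a, x⟫ • a - ⟪e, x⟫ • e, y - ⟪a, y⟫ • a - ⟪e, y⟫ • e⟫
      = ⟪x, y⟫ - ⟪a, x⟫ * ⟪a, y⟫ - ⟪e, x⟫ * ⟪e, y⟫ := by
    intro x y
    have hea : ⟪e, a⟫ = 0 := by rw [real_inner_comm]; exact hae
    have haa : ⟪a, a⟫ = 1 := by rw [real_inner_self_eq_norm_sq, ha]; norm_num
    have hee : ⟪e, e⟫ = 1 := by rw [real_inner_self_eq_norm_sq, hen]; norm_num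
    simp only [inner_sub_left, inner_sub_right, real_inner_smul_left, real_inner_smul_right,
      hae, hea, haa, hee]
    rw [real_inner_comm a x, real_inner_comm e x]
    ring
  set p' := p - ⟪a, p⟫ • a - ⟪e, p⟫ • e with hp'
  set c' := c - ⟪a, c⟫ • a - ⟪e, c⟫ • e with hc'
  have hpu : ⟪a, p⟫ ^ 2 + ‖p'‖ ^ 2 + ⟪e, p⟫ ^ 2 = 1 := by
    have := hsplit p p
    rw [real_inner_self_eq_norm_sq, real_inner_self_eq_norm_sq p, hp] at this
    rw [hp', this]; ring
  have hcu : ⟪a, c⟫ ^ 2 + ‖c'‖ ^ 2 + ⟪e, c⟫ ^ 2 = 1 := by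
    have := hsplit c c
    rw [real_inner_self_eq_norm_sq, real_inner_self_eq_norm_sq c, hc] at this
    rw [hc', this]; ring
  have hcs : ⟪c, p⟫ ≤ ⟪a, p⟫ * ⟪a, c⟫ + ‖p'‖ * ‖c'‖ + ⟪e, p⟫ * ⟪e, c⟫ := by
    have h3 := hsplit p c
    have h4 := real_inner_le_norm p' c'
    rw [hp', hc', h3, real_inner_comm] at h4
    linarith
  have hec := hie c
  have hep := hie p
  have hτc : 0 ≤ τ * ⟪a, c⟫ := mul_nonneg hτ0 hac
  have hτp : τ * ⟪a, c⟫ ≤ τ * ⟪a, p⟫ := mul_le_mul_of_nonneg_left h1.le hτ0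
  have hc3 : 0 < ⟪e, c⟫ := by
    by_contra h
    nlinarith
  have h3 : ⟪e, c⟫ < ⟪e, p⟫ := by
    by_contra h
    nlinarith
  have hmain := aux_real _ _ _ _ _ _ (norm_nonneg p') (norm_nonneg c') hac hc3.le h1 h3 hpu hcu
  have hγ : √(1 - (⟪a, p⟫ * ⟪a, c⟫ + ‖p'‖ * ‖c'‖ + ⟪e, p⟫ * ⟪e, c⟫) ^ 2) ≤ dS c p := by
    apply Real.sqrt_le_sqrt
    nlinarith
  have hb3 : dS b c - dS b p ≤ dS e c - dS e p :=
    aux_b _ _ _ _ _ _ _ hρ0 hρ1 hτc hτp hbc h2 hc3 h3 (inner_le_one e p hen hp) hec hep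
  have d1 : dS a c = √(1 - ⟪a, c⟫ ^ 2) := rfl
  have d2 : dS a p = √(1 - ⟪a, p⟫ ^ 2) := rfl
  have d3 : dS e c = √(1 - ⟪e, c⟫ ^ 2) := rfl
  have d4 : dS e p = √(1 - ⟪e, p⟫ ^ 2) := rfl
  linarith

theorem aux_main (a b c p : EuclideanSpace ℝ (Fin 3))
    (ha : ‖a‖ = 1) (hb : ‖b‖ = 1) (hc : ‖c‖ = 1) (hp : ‖p‖ = 1)
    (hab : ⟪a, b⟫ ≤ 0) (hac : 0 ≤ ⟪a, c⟫) (hbc : 0 < ⟪b, c⟫)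
    (hbp : 0 < ⟪b, p⟫) (hcp : 0 < ⟪c, p⟫) (hbap : ⟪b, p⟫ ≤ ⟪a, p⟫) (hcap : ⟪c, p⟫ ≤ ⟪a, p⟫) :
    J a b c c < J a b c p := by
  have hcc : dS c c = 0 := by
    rw [dS, real_inner_self_eq_norm_sq, hc]; simp
  have goal : dS a c + dS b c < dS a p + dS b p + dS c p → J a b c c < J a b c p := by
    intro h; rw [J, J, hcc]; linarith
  apply goal
  have hap : ⟪a, p⟫ < 1 := by
    refine lt_of_le_of_ne (inner_le_one a p ha hp) fun h => ?_
    have := (inner_eq_one_iff_of_norm_eq_one ha hp).mp h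
    subst this
    rw [real_inner_comm] at hbp
    linarith
  have hcpos : 0 < dS c p := by
    apply Real.sqrt_pos.mpr
    nlinarith
  rcases le_or_gt ⟪b, p⟫ ⟪b, c⟫ with h | h
  · have t := dS_tri a p c ha hp hc (by linarith)
    rw [dS_comm p c] at t
    have : dS b c ≤ dS b p := Real.sqrt_le_sqrt (by nlinarith)
    nlinarith
  rcases le_or_gt ⟪a, p⟫ ⟪a, c⟫ with h' | h'
  · have t := dS_tri b p c hb hp hc (by linarith)
    rw [dS_comm p c] at t
    have : dS a c ≤ dS a p := Real.sqrt_le_sqrt (by nlinarith)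
    nlinarith
  exact aux_case3 a b c p ha hb hc hp hab hac hbc hcp h' h

theorem stmt14 (a b c p : EuclideanSpace ℝ (Fin 3))
    (ha : ‖a‖ = 1) (hb : ‖b‖ = 1) (hc : ‖c‖ = 1)
    (hli : LinearIndependent ℝ ![a, b, c])
    (hbig : ⟪a, b⟫ * ⟪a, c⟫ * ⟪b, c⟫ ≤ 0)
    (hp : IsMinimizer a b c p)
    (hap : 0 ≤ ⟪a, p⟫) (hbp : 0 ≤ ⟪b, p⟫) (hcp : 0 ≤ ⟪c, p⟫)
    (hab : ⟪b, p⟫ ≤ ⟪a, p⟫) (hac : ⟪c, p⟫ ≤ ⟪a, p⟫) :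
    ∃ εb εc : ℝ, (εb = 1 ∨ εb = -1) ∧ (εc = 1 ∨ εc = -1) ∧
      0 ≤ ⟪εb • b, p⟫ ∧ 0 ≤ ⟪εc • c, p⟫ ∧
      ⟪εb • b, p⟫ ≤ ⟪a, p⟫ ∧ ⟪εc • c, p⟫ ≤ ⟪a, p⟫ ∧
      ⟪εb • b, εc • c⟫ ≤ 0 := by
  obtain ⟨hpn, hmin⟩ := hp
  rcases le_or_gt ⟪b, c⟫ 0 with h | hbc
  · exact ⟨1, 1, Or.inl rfl, Or.inl rfl, by simpa using hbp, by simpa using hcp,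
      by simpa using hab, by simpa using hac, by simpa using h⟩
  rcases hbp.eq_or_lt with h | hbp
  · refine ⟨-1, 1, Or.inr rfl, Or.inl rfl, ?_, by simpa using hcp, ?_, by simpa using hac, ?_⟩
    · rw [real_inner_smul_left, ← h]; simp
    · rw [real_inner_smul_left, ← h]; simpa using hap
    · rw [real_inner_smul_left, one_smul]; linarith
  rcases hcp.eq_or_lt with h | hcp
  · refine ⟨1, -1, Or.inl rfl, Or.inr rfl, by simpa using hbp.le, ?_, by simpa using hab, ?_, ?_⟩
    · rw [real_inner_smul_left, ← h]; simp
    · rw [real_inner_smul_left, ← h]; simpa using hap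
    · rw [real_inner_smul_right, one_smul]; linarith
  exfalso
  have hprod : ⟪a, b⟫ * ⟪a, c⟫ ≤ 0 := by
    by_contra hcon
    push Not at hcon
    have := mul_pos hcon hbc
    linarith
  rcases mul_nonpos_iff.mp hprod with ⟨h1, h2⟩ | ⟨h1, h2⟩
  · have := aux_main a c b p ha hc hb hpn h2 h1 (by rwa [real_inner_comm]) hcp hbp hac hab
    have h3 := hmin b hb
    rw [J, J] at this h3
    linarith
  · have := aux_main a b c p ha hb hc hpn h1 h2 hbc hbp hcp hab hac
    have h3 := hmin c hc
    linarith
end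

section
/- Let a, b, c be linearly independent unit vectors in ℝ³ with ⟪a,b⟫ = ⟪a,c⟫ = ⟪b,c⟫ = z for some real z with 0 < z < 1 (an equilateral configuration with common angle strictly between 0° and 90°), and let p be a unit vector that is a minimizer for (a,b,c). Then at least two of the three quantities ⟪a,p⟫², ⟪b,p⟫², ⟪c,p⟫² are equal; equivalently, at least two of √(1-⟪a,p⟫²), √(1-⟪b,p⟫²), √(1-⟪c,p⟫²) are equal. -/
open RealInnerProductSpace

noncomputable def fS (x : ℝ) : ℝ := x / Real.sqrt (1 - x ^ 2)

lemma fS_hasDeriv (x : ℝ) (h : 0 < 1 - x ^ 2) :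
    HasDerivAt fS (1 / (Real.sqrt (1 - x ^ 2)) ^ 3) x := by
  have hs : 0 < Real.sqrt (1 - x ^ 2) := Real.sqrt_pos.2 h
  have h1 : HasDerivAt (fun y : ℝ => 1 - y ^ 2) (-(2 * x)) x := by
    simpa using ((hasDerivAt_id x).pow 2).const_sub 1
  have h2 := (hasDerivAt_id x).div (h1.sqrt h.ne') hs.ne'
  refine h2.congr_deriv ?_
  have hsq := Real.sq_sqrt h.le
  simp only [id]
  field_simp
  rw [hsq]
  ring

lemma fS_convex : StrictConvexOn ℝ (Set.Ico (0 : ℝ) 1) fS := by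
  have hpos : ∀ x ∈ Set.Ico (0 : ℝ) 1, 0 < 1 - x ^ 2 := by
    rintro x ⟨h0, h1⟩
    nlinarith
  apply StrictMonoOn.strictConvexOn_of_deriv (convex_Ico _ _)
  · intro x hx
    exact (fS_hasDeriv x (hpos x hx)).continuousAt.continuousWithinAt
  · intro x hx y hy hxy
    have hx := interior_subset hx
    have hy := interior_subset hy
    rw [(fS_hasDeriv x (hpos x hx)).deriv, (fS_hasDeriv y (hpos y hy)).deriv]
    have hsy : 0 < Real.sqrt (1 - y ^ 2) := Real.sqrt_pos.2 (hpos y hy)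
    have hlt : Real.sqrt (1 - y ^ 2) < Real.sqrt (1 - x ^ 2) := by
      apply Real.sqrt_lt_sqrt (hpos y hy).le
      nlinarith [hx.1]
    apply one_div_lt_one_div_of_lt (by positivity)
    gcongr

lemma fS_three {x y w : ℝ} (h0 : 0 ≤ x) (h1 : w < 1) (hxy : x < y) (hyw : y < w) :
    0 < fS x * (w - y) + fS y * (x - w) + fS w * (y - x) := by
  have h := fS_convex.slope_strict_mono_adjacent (x := x) (y := y) (z := w)
    ⟨h0, by linarith⟩ ⟨by linarith, h1⟩ hxy hyw
  rw [div_lt_div_iff₀ (by linarith) (by linarith)] at h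
  nlinarith

lemma fS_eq {x y w : ℝ} (hx : 0 ≤ x) (hy : 0 ≤ y) (hw : 0 ≤ w) (hx1 : x < 1) (hy1 : y < 1)
    (hw1 : w < 1) (h : fS x * (y - w) + fS y * (w - x) + fS w * (x - y) = 0) :
    x = y ∨ x = w ∨ y = w := by
  by_contra! hne
  obtain ⟨n1, n2, n3⟩ := hne
  rcases lt_or_gt_of_ne n1 with a1 | a1 <;> rcases lt_or_gt_of_ne n2 with a2 | a2 <;>
    rcases lt_or_gt_of_ne n3 with a3 | a3 <;> try linarith
  · linarith [fS_three hx hw1 a1 a3]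
  · linarith [fS_three hx hy1 a2 a3]
  · linarith [fS_three hw hy1 a2 a1]
  · linarith [fS_three hy hw1 a1 a2]
  · linarith [fS_three hy hx1 a3 a2]
  · linarith [fS_three hw hx1 a3 a1]

lemma path_deriv (x u C : ℝ) (hx : 0 < 1 - x ^ 2) :
    HasDerivAt (fun t : ℝ => Real.sqrt (1 - (x + t * u) ^ 2 / (1 + t ^ 2 * C)))
      (-(fS x * u)) 0 := by
  have h1 : HasDerivAt (fun t : ℝ => (x + t * u) ^ 2) (2 * x * u) 0 := by
    simpa using (((hasDerivAt_id (0 : ℝ)).mul_const u).const_add x).fun_pow 2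
  have h2 : HasDerivAt (fun t : ℝ => 1 + t ^ 2 * C) 0 0 := by
    simpa using (((hasDerivAt_id (0 : ℝ)).pow 2).mul_const C).const_add 1
  have h3 := ((h1.fun_div h2 (by simp)).const_sub 1).sqrt (by simpa using hx.ne')
  refine h3.congr_deriv ?_
  have hs : 0 < Real.sqrt (1 - x ^ 2) := Real.sqrt_pos.2 hx
  simp [fS]
  field_simp

lemma dS_scale (a v : EuclideanSpace ℝ (Fin 3)) :
    dS a (‖v‖⁻¹ • v) = Real.sqrt (1 - ⟪a, v⟫ ^ 2 / ‖v‖ ^ 2) := by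
  unfold dS
  rw [real_inner_smul_right]
  congr 2
  rw [mul_pow, inv_pow]
  ring

lemma norm_scale {v : EuclideanSpace ℝ (Fin 3)} (h : v ≠ 0) : ‖‖v‖⁻¹ • v‖ = 1 := by
  rw [norm_smul, norm_inv, norm_norm]
  exact inv_mul_cancel₀ (norm_ne_zero_iff.2 h)

lemma inner_lt {a p : EuclideanSpace ℝ (Fin 3)} (ha : ‖a‖ = 1) (hp : ‖p‖ = 1) (hne : a ≠ p) :
    ⟪a, p⟫ < 1 := by
  refine lt_of_le_of_ne ?_ ?_
  · have := real_inner_le_norm a p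
    rwa [ha, hp, one_mul] at this
  · intro h
    exact hne ((inner_eq_one_iff_of_norm_eq_one ha hp).1 h)

lemma main_nonneg (a b c p : EuclideanSpace ℝ (Fin 3)) (z : ℝ)
    (ha : ‖a‖ = 1) (hb : ‖b‖ = 1) (hc : ‖c‖ = 1)
    (hab : ⟪a, b⟫ = z) (hac : ⟪a, c⟫ = z) (hbc : ⟪b, c⟫ = z)
    (hz1 : z < 1) (hp : IsMinimizer a b c p)
    (hx : 0 ≤ ⟪a, p⟫) (hy : 0 ≤ ⟪b, p⟫) (hw : 0 ≤ ⟪c, p⟫) :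
    ⟪a, p⟫ = ⟪b, p⟫ ∨ ⟪a, p⟫ = ⟪c, p⟫ ∨ ⟪b, p⟫ = ⟪c, p⟫ := by
  have hba : ⟪b, a⟫ = z := by rw [real_inner_comm]; exact hab
  have hca : ⟪c, a⟫ = z := by rw [real_inner_comm]; exact hac
  have hcb : ⟪c, b⟫ = z := by rw [real_inner_comm]; exact hbc
  by_cases e1 : a = p
  · subst e1; right; right; rw [hba, hca]
  by_cases e2 : b = p
  · subst e2; right; left; rw [hab, hcb]
  by_cases e3 : c = p
  · subst e3; left; rw [hac, hbc]
  obtain ⟨hp1, hmin⟩ := hp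
  have hx1 := inner_lt ha hp1 e1
  have hy1 := inner_lt hb hp1 e2
  have hw1 := inner_lt hc hp1 e3
  have haa : ⟪a, a⟫ = 1 := by rw [real_inner_self_eq_norm_sq, ha]; norm_num
  have hbb : ⟪b, b⟫ = 1 := by rw [real_inner_self_eq_norm_sq, hb]; norm_num
  have hcc : ⟪c, c⟫ = 1 := by rw [real_inner_self_eq_norm_sq, hc]; norm_num
  have hz : 1 - z ≠ 0 := by linarith
  set x := ⟪a, p⟫ with hxd
  set y := ⟪b, p⟫ with hyd
  set w := ⟪c, p⟫ with hwd
  apply fS_eq hx hy hw hx1 hy1 hw1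
  let r : EuclideanSpace ℝ (Fin 3) := (1 - z)⁻¹ • ((y - w) • a + (w - x) • b + (x - y) • c)
  have har : ⟪a, r⟫ = y - w := by
    simp only [r, inner_add_right, real_inner_smul_right, haa, hab, hac]
    field_simp; ring
  have hbr : ⟪b, r⟫ = w - x := by
    simp only [r, inner_add_right, real_inner_smul_right, hba, hbb, hbc]
    field_simp; ring
  have hcr : ⟪c, r⟫ = x - y := by
    simp only [r, inner_add_right, real_inner_smul_right, hca, hcb, hcc]
    field_simp; ring
  have hpr : ⟪p, r⟫ = 0 := by
    simp only [r, inner_add_right, real_inner_smul_right, real_inner_comm a p,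
      real_inner_comm b p, real_inner_comm c p, ← hxd, ← hyd, ← hwd]
    ring
  have hn : ∀ t : ℝ, ‖p + t • r‖ ^ 2 = 1 + t ^ 2 * ‖r‖ ^ 2 := by
    intro t
    rw [norm_add_sq_real, real_inner_smul_right, hpr, hp1, norm_smul, mul_pow]
    simp
  have hne : ∀ t : ℝ, p + t • r ≠ 0 := by
    intro t h
    have := hn t
    rw [h] at this
    simp only [norm_zero] at this
    nlinarith [mul_nonneg (sq_nonneg t) (sq_nonneg ‖r‖)]
  have hD := ((path_deriv x (y - w) (‖r‖ ^ 2) (by nlinarith)).add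
    (path_deriv y (w - x) (‖r‖ ^ 2) (by nlinarith))).add
    (path_deriv w (x - y) (‖r‖ ^ 2) (by nlinarith))
  have hloc := IsLocalMin.hasDerivAt_eq_zero (Filter.Eventually.of_forall ?_) hD
  · linarith
  · intro t
    have h := hmin _ (norm_scale (hne t))
    simp only [J, dS_scale, hn, inner_add_right, real_inner_smul_right, har, hbr, hcr] at h
    simpa [dS, ← hxd, ← hyd, ← hwd] using h

theorem stmt15 (a b c p : EuclideanSpace ℝ (Fin 3)) (z : ℝ)
    (ha : ‖a‖ = 1) (hb : ‖b‖ = 1) (hc : ‖c‖ = 1)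
    (hli : LinearIndependent ℝ ![a, b, c])
    (hab : ⟪a, b⟫ = z) (hac : ⟪a, c⟫ = z) (hbc : ⟪b, c⟫ = z)
    (hz0 : 0 < z) (hz1 : z < 1)
    (hp : IsMinimizer a b c p) :
    ⟪a, p⟫ ^ 2 = ⟪b, p⟫ ^ 2 ∨ ⟪a, p⟫ ^ 2 = ⟪c, p⟫ ^ 2 ∨ ⟪b, p⟫ ^ 2 = ⟪c, p⟫ ^ 2 := by
  have hba : ⟪b, a⟫ = z := by rw [real_inner_comm]; exact hab
  have hca : ⟪c, a⟫ = z := by rw [real_inner_comm]; exact hac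
  have hcb : ⟪c, b⟫ = z := by rw [real_inner_comm]; exact hbc
  have haa : ⟪a, a⟫ = 1 := by rw [real_inner_self_eq_norm_sq, ha]; norm_num
  have hbb : ⟪b, b⟫ = 1 := by rw [real_inner_self_eq_norm_sq, hb]; norm_num
  have hcc : ⟪c, c⟫ = 1 := by rw [real_inner_self_eq_norm_sq, hc]; norm_num
  have hz : 1 - z ≠ 0 := by linarith
  have hzp : 0 < 1 - z := by linarith
  have hz2 : 1 + 2 * z ≠ 0 := by linarith
  obtain ⟨k, hk⟩ : ∃ k : ℝ, k = z / (1 + 2 * z) := ⟨_, rfl⟩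
  have hk0 : 0 < k := by rw [hk]; positivity
  have hkz : k * (1 + 2 * z) = z := by rw [hk]; field_simp
  let V : ℝ → ℝ → ℝ → EuclideanSpace ℝ (Fin 3) := fun X Y W =>
    (1 - z)⁻¹ • ((X - k * (X + Y + W)) • a + (Y - k * (X + Y + W)) • b
      + (W - k * (X + Y + W)) • c)
  have hVa : ∀ X Y W, ⟪a, V X Y W⟫ = X := by
    intro X Y W
    simp only [V, inner_add_right, real_inner_smul_right, haa, hab, hac]
    field_simp
    linear_combination (-(X + Y + W)) * hkz
  have hVb : ∀ X Y W, ⟪b, V X Y W⟫ = Y := by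
    intro X Y W
    simp only [V, inner_add_right, real_inner_smul_right, hba, hbb, hbc]
    field_simp
    linear_combination (-(X + Y + W)) * hkz
  have hVc : ∀ X Y W, ⟪c, V X Y W⟫ = W := by
    intro X Y W
    simp only [V, inner_add_right, real_inner_smul_right, hca, hcb, hcc]
    field_simp
    linear_combination (-(X + Y + W)) * hkz
  have hVi : ∀ (X Y W : ℝ) (v : EuclideanSpace ℝ (Fin 3)), ⟪v, V X Y W⟫ =
      (1 - z)⁻¹ * ((X - k * (X + Y + W)) * ⟪a, v⟫ + (Y - k * (X + Y + W)) * ⟪b, v⟫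
        + (W - k * (X + Y + W)) * ⟪c, v⟫) := by
    intro X Y W v
    simp only [V, inner_add_right, real_inner_smul_right, real_inner_comm a v,
      real_inner_comm b v, real_inner_comm c v]
  have hVn : ∀ X Y W, ‖V X Y W‖ ^ 2 =
      (1 - z)⁻¹ * (X ^ 2 + Y ^ 2 + W ^ 2 - k * (X + Y + W) ^ 2) := by
    intro X Y W
    rw [← real_inner_self_eq_norm_sq, hVi, hVa, hVb, hVc]
    ring
  obtain ⟨hp1, hmin⟩ := hp
  obtain ⟨x, hx⟩ : ∃ x, x = ⟪a, p⟫ := ⟨_, rfl⟩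
  obtain ⟨y, hy⟩ : ∃ y, y = ⟪b, p⟫ := ⟨_, rfl⟩
  obtain ⟨w, hw⟩ : ∃ w, w = ⟪c, p⟫ := ⟨_, rfl⟩
  rw [← hx, ← hy, ← hw]
  have hbes : (1 - z)⁻¹ * (x ^ 2 + y ^ 2 + w ^ 2 - k * (x + y + w) ^ 2) ≤ 1 := by
    have h := sq_nonneg ‖p - V x y w‖
    rw [norm_sub_sq_real, hVn, hVi, hp1, ← hx, ← hy, ← hw] at h
    linarith
  obtain ⟨q, hq⟩ : ∃ q, q = V |x| |y| |w| := ⟨_, rfl⟩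
  have hqa : ⟪a, q⟫ = |x| := by rw [hq, hVa]
  have hqb : ⟪b, q⟫ = |y| := by rw [hq, hVb]
  have hqc : ⟪c, q⟫ = |w| := by rw [hq, hVc]
  have hqn : ‖q‖ ^ 2 ≤ 1 := by
    rw [hq, hVn]
    refine le_trans ?_ hbes
    simp only [sq_abs]
    have : (x + y + w) ^ 2 ≤ (|x| + |y| + |w|) ^ 2 := by
      rw [← sq_abs (x + y + w)]
      have := abs_add_three x y w
      gcongr
    gcongr
  by_cases hq0 : q = 0
  · left
    rw [hq0, inner_zero_right] at hqa hqb
    rw [← sq_abs x, ← sq_abs y, ← hqa, ← hqb]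
  have hqpos : 0 < ‖q‖ := norm_pos_iff.2 hq0
  have hle : ∀ v : EuclideanSpace ℝ (Fin 3), ∀ s : ℝ, s = ⟪v, p⟫ → ⟪v, q⟫ = |s| →
      dS v (‖q‖⁻¹ • q) ≤ dS v p := by
    intro v s hs hv
    rw [dS_scale, hv, sq_abs, dS, ← hs]
    apply Real.sqrt_le_sqrt
    have : s ^ 2 ≤ s ^ 2 / ‖q‖ ^ 2 := by
      rw [le_div_iff₀ (by positivity)]
      nlinarith [sq_nonneg s]
    linarith
  have hmq : IsMinimizer a b c (‖q‖⁻¹ • q) := by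
    refine ⟨norm_scale hq0, fun u hu => le_trans ?_ (hmin u hu)⟩
    unfold J
    linarith [hle a x hx hqa, hle b y hy hqb, hle c w hw hqc]
  have hfin := main_nonneg a b c _ z ha hb hc hab hac hbc hz1 hmq
    (by rw [real_inner_smul_right, hqa]; positivity)
    (by rw [real_inner_smul_right, hqb]; positivity)
    (by rw [real_inner_smul_right, hqc]; positivity)
  simp only [real_inner_smul_right, hqa, hqb, hqc] at hfin
  have hi : ‖q‖⁻¹ ≠ 0 := by positivity
  rcases hfin with h | h | h
  · exact Or.inl (sq_eq_sq_iff_abs_eq_abs _ _ |>.2 (mul_left_cancel₀ hi h))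
  · exact Or.inr (Or.inl (sq_eq_sq_iff_abs_eq_abs _ _ |>.2 (mul_left_cancel₀ hi h)))
  · exact Or.inr (Or.inr (sq_eq_sq_iff_abs_eq_abs _ _ |>.2 (mul_left_cancel₀ hi h)))
end

section
/- Let α, β be real numbers with π/6 ≤ α < π/4 and 0 < β < π/2, and set a = (cos α, sin α, 0), b = (cos α, -sin α, 0), c = (cos β, 0, sin β) in ℝ³; assume cos α · cos β < cos 2α (so the projective angles satisfy 60° ≤ φ_AB < φ_AC = φ_BC < 90°). Let p = (p_x, p_y, p_z) be a unit vector that is a minimizer for (a,b,c) and assume p_x ≥ 0 and p_y ≥ 0. Then p_z ≥ 0, ⟪a,p⟫ ≥ 0, ⟪b,p⟫ ≥ 0 and ⟪c,p⟫ ≥ 0. -/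
open RealInnerProductSpace

lemma aux_J (c s B D : ℝ) (a b e q : EuclideanSpace ℝ (Fin 3))
    (hae : a = ![c, s, 0]) (hbe : b = ![c, -s, 0]) (hce : e = ![B, 0, D]) :
    ⟪a, q⟫ = q 0 * c + q 1 * s ∧ ⟪b, q⟫ = q 0 * c - q 1 * s ∧ ⟪e, q⟫ = q 0 * B + q 2 * D ∧
    J a b e q = √(1 - (q 0 * c + q 1 * s) ^ 2) + √(1 - (q 0 * c - q 1 * s) ^ 2)
      + √(1 - (q 0 * B + q 2 * D) ^ 2) := by
  have h1 : ⟪a, q⟫ = q 0 * c + q 1 * s := by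
    simp [PiLp.inner_apply, Fin.sum_univ_three, hae]
  have h2 : ⟪b, q⟫ = q 0 * c - q 1 * s := by
    simp [PiLp.inner_apply, Fin.sum_univ_three, hbe]; ring
  have h3 : ⟪e, q⟫ = q 0 * B + q 2 * D := by
    simp [PiLp.inner_apply, Fin.sum_univ_three, hce]
  refine ⟨h1, h2, h3, ?_⟩
  simp only [J, dS, h1, h2, h3]

lemma aux_norm (q : EuclideanSpace ℝ (Fin 3)) :
    ‖q‖ = 1 ↔ q 0 ^ 2 + q 1 ^ 2 + q 2 ^ 2 = 1 := by
  rw [EuclideanSpace.norm_eq, Real.sqrt_eq_one]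
  simp [Fin.sum_univ_three]

/-- The chord of the concave function `t ↦ √(1 - t (1 - c²))` lies below it. -/
lemma aux_conc (t c : ℝ) (ht0 : 0 ≤ t) (ht1 : t ≤ 1) :
    t * c + (1 - t) ≤ √(1 - t * (1 - c ^ 2)) := by
  apply Real.le_sqrt_of_sq_le
  nlinarith [mul_nonneg (mul_nonneg ht0 (sub_nonneg.2 ht1)) (sq_nonneg (1 - c))]

set_option maxHeartbeats 1000000 in
lemma aux_main_s16 (c s B D x y z : ℝ) (hs : 0 < s) (hsc : s < c) (hB : 0 < B) (hD : 0 < D)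
    (h1 : c ^ 2 + s ^ 2 = 1) (h2 : B ^ 2 + D ^ 2 = 1) (hp : x ^ 2 + y ^ 2 + z ^ 2 = 1)
    (hx : 0 ≤ x) (hy : 0 ≤ y)
    (hmin : ∀ x' y' z' : ℝ, x' ^ 2 + y' ^ 2 + z' ^ 2 = 1 →
      √(1 - (x * c + y * s) ^ 2) + √(1 - (x * c - y * s) ^ 2) + √(1 - (x * B + z * D) ^ 2) ≤
      √(1 - (x' * c + y' * s) ^ 2) + √(1 - (x' * c - y' * s) ^ 2) + √(1 - (x' * B + z' * D) ^ 2)) :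
    0 ≤ z ∧ 0 ≤ x * c - y * s := by
  have hc : 0 < c := hs.trans hsc
  have hz : 0 ≤ z := by
    by_contra! hz
    rcases hx.eq_or_lt with hx0 | hx0
    · subst hx0
      have ht1 : y ^ 2 ≤ 1 := by nlinarith [sq_nonneg z]
      have e1 := aux_conc (y ^ 2) c (sq_nonneg y) ht1
      have e2 := aux_conc (z ^ 2) B (sq_nonneg z) (by nlinarith [sq_nonneg y])
      have m1 := hmin 1 0 0 (by norm_num)
      have m2 := hmin B 0 D (by linarith)
      have r1 : 1 - ((0:ℝ) * c + y * s) ^ 2 = 1 - y ^ 2 * (1 - c ^ 2) := by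
        rw [← h1]; ring
      have r2 : 1 - ((0:ℝ) * c - y * s) ^ 2 = 1 - y ^ 2 * (1 - c ^ 2) := by
        rw [← h1]; ring
      have r3 : 1 - ((0:ℝ) * B + z * D) ^ 2 = 1 - z ^ 2 * (1 - B ^ 2) := by
        rw [← h2]; ring
      rw [r1, r2, r3] at m1 m2
      have k1 : √(1 - ((1:ℝ) * c + 0 * s) ^ 2) < c := by
        rw [Real.sqrt_lt' hc]; nlinarith
      have k2 : √(1 - ((1:ℝ) * c - 0 * s) ^ 2) < c := by
        rw [Real.sqrt_lt' hc]; nlinarith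
      have k3 : √(1 - ((1:ℝ) * B + 0 * D) ^ 2) ≤ 1 := by
        exact Real.sqrt_le_one.2 (by linarith [sq_nonneg ((1:ℝ) * B + 0 * D)])
      have l1 : √(1 - (B * c + 0 * s) ^ 2) ≤ 1 := by
        exact Real.sqrt_le_one.2 (by linarith [sq_nonneg (B * c + 0 * s)])
      have l2 : √(1 - (B * c - 0 * s) ^ 2) ≤ 1 := by
        exact Real.sqrt_le_one.2 (by linarith [sq_nonneg (B * c - 0 * s)])
      have l3 : √(1 - (B * B + D * D) ^ 2) = 0 := by
        have : B * B + D * D = 1 := by linarith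
        rw [this]; norm_num
      have hz2 : z ^ 2 = 1 - y ^ 2 := by linarith
      have hz3 : 0 < 1 - y ^ 2 := by rw [← hz2]; exact sq_pos_of_neg hz
      set T := √(1 - y ^ 2 * (1 - c ^ 2)) + √(1 - y ^ 2 * (1 - c ^ 2)) + √(1 - z ^ 2 * (1 - B ^ 2))
      have t1 : T < 2 * c + 1 := by linarith
      have t2 : T < 2 + B := by linarith
      have t3 : y ^ 2 * (2 * c + 1) + (1 - y ^ 2) * (2 + B) ≤ T := by
        rw [hz2] at e2
        have : T = √(1 - y ^ 2 * (1 - c ^ 2)) + √(1 - y ^ 2 * (1 - c ^ 2))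
          + √(1 - (1 - y ^ 2) * (1 - B ^ 2)) := by rw [← hz2]
        rw [this]; linarith
      nlinarith [mul_nonneg (sq_nonneg y) (sub_nonneg.2 t1.le), mul_pos hz3 (sub_pos.2 t2)]
    · have m := hmin x y (-z) (by linarith)
      have : √(1 - (x * B + -z * D) ^ 2) < √(1 - (x * B + z * D) ^ 2) := by
        apply Real.sqrt_lt_sqrt
        · have : (x * B + -z * D) ^ 2 + (x * D + z * B) ^ 2 = (x ^ 2 + z ^ 2) * (B ^ 2 + D ^ 2) := by
            ring
          rw [h2] at this
          nlinarith [sq_nonneg (x * D + z * B), sq_nonneg y]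
        · nlinarith [mul_pos (mul_pos hx0 (neg_pos.2 hz)) (mul_pos hB hD)]
      linarith
  refine ⟨hz, ?_⟩
  by_contra! hv
  have hyx : 0 < y * c - x * s := by nlinarith
  have hy0 : 0 < y := by nlinarith
  set x' := (c ^ 2 - s ^ 2) * x + 2 * s * c * y with hx'
  set y' := 2 * s * c * x - (c ^ 2 - s ^ 2) * y with hy'
  have n0 : x' ^ 2 + y' ^ 2 = x ^ 2 + y ^ 2 := by
    have : x' ^ 2 + y' ^ 2 = (c ^ 2 + s ^ 2) ^ 2 * (x ^ 2 + y ^ 2) := by rw [hx', hy']; ring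
    rw [this, h1]; ring
  have m := hmin x' y' z (by linarith)
  have u' : x' * c + y' * s = x * c + y * s := by
    have : x' * c + y' * s = (c ^ 2 + s ^ 2) * (x * c + y * s) := by rw [hx', hy']; ring
    rw [this, h1]; ring
  have v1 : (x' * c - y' * s) - (x * c - y * s) = 4 * s * c * (y * c - x * s) := by
    have : (x' * c - y' * s) - (c ^ 2 + s ^ 2) * (x * c - y * s) = 4 * s * c * (y * c - x * s) := by
      rw [hx', hy']; ring
    rw [h1] at this; linarith
  have v2 : (x' * c - y' * s) + (x * c - y * s) = 2 * (c ^ 2 - s ^ 2) * (x * c + y * s) := by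
    have : (x' * c - y' * s) + (c ^ 2 + s ^ 2) * (x * c - y * s)
        = 2 * (c ^ 2 - s ^ 2) * (x * c + y * s) := by
      rw [hx', hy']; ring
    rw [h1] at this; linarith
  have v1p : 0 < (x' * c - y' * s) - (x * c - y * s) := by rw [v1]; positivity
  have v2p : 0 < (x' * c - y' * s) + (x * c - y * s) := by
    rw [v2]
    have : 0 < c ^ 2 - s ^ 2 := by
      have := mul_pos (sub_pos.2 hsc) (add_pos hc hs)
      linarith
    positivity
  have xx : x ≤ x' := by
    have : x' - (c ^ 2 + s ^ 2) * x = 2 * s * (y * c - x * s) := by rw [hx']; ring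
    rw [h1] at this
    have : 0 < 2 * s * (y * c - x * s) := by positivity
    linarith
  have lt : √(1 - (x' * c - y' * s) ^ 2) < √(1 - (x * c - y * s) ^ 2) := by
    apply Real.sqrt_lt_sqrt
    · have : (x' * c - y' * s) ^ 2 + (x' * s + y' * c) ^ 2 = (x' ^ 2 + y' ^ 2) * (c ^ 2 + s ^ 2) := by
        ring
      rw [h1] at this
      nlinarith [sq_nonneg (x' * s + y' * c), sq_nonneg z]
    · nlinarith [mul_pos v1p v2p]
  have le : √(1 - (x' * B + z * D) ^ 2) ≤ √(1 - (x * B + z * D) ^ 2) := by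
    apply Real.sqrt_le_sqrt
    have : 0 ≤ x * B + z * D := by positivity
    have : x * B + z * D ≤ x' * B + z * D := by gcongr
    have : (x * B + z * D) ^ 2 ≤ (x' * B + z * D) ^ 2 := by gcongr
    linarith
  rw [u'] at m
  linarith

theorem stmt16 (α β : ℝ)
    (hα1 : Real.pi / 6 ≤ α) (hα2 : α < Real.pi / 4)
    (hβ1 : 0 < β) (hβ2 : β < Real.pi / 2)
    (a b c : EuclideanSpace ℝ (Fin 3))
    (hae : a = ![Real.cos α, Real.sin α, 0])
    (hbe : b = ![Real.cos α, -Real.sin α, 0])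
    (hce : c = ![Real.cos β, 0, Real.sin β])
    (hangle : Real.cos α * Real.cos β < Real.cos (2 * α))
    (p : EuclideanSpace ℝ (Fin 3))
    (hp : IsMinimizer a b c p)
    (hpx : 0 ≤ p 0) (hpy : 0 ≤ p 1) :
    0 ≤ p 2 ∧ 0 ≤ ⟪a, p⟫ ∧ 0 ≤ ⟪b, p⟫ ∧ 0 ≤ ⟪c, p⟫ := by
  have hs : 0 < Real.sin α := Real.sin_pos_of_pos_of_lt_pi (by linarith [Real.pi_pos]) (by linarith [Real.pi_pos])
  have hsc : Real.sin α < Real.cos α := by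
    rw [← Real.cos_pi_div_two_sub]
    apply Real.cos_lt_cos_of_nonneg_of_le_pi <;> linarith [Real.pi_pos]
  have hB : 0 < Real.cos β := Real.cos_pos_of_mem_Ioo ⟨by linarith, hβ2⟩
  have hD : 0 < Real.sin β := Real.sin_pos_of_pos_of_lt_pi hβ1 (by linarith)
  obtain ⟨hn, hm⟩ := hp
  rw [aux_norm] at hn
  obtain ⟨ia, ib, ic, hJ⟩ := aux_J _ _ _ _ a b c p hae hbe hce
  obtain ⟨hz, hv⟩ := aux_main_s16 (Real.cos α) (Real.sin α) (Real.cos β) (Real.sin β) (p 0) (p 1) (p 2)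
    hs hsc hB hD (Real.cos_sq_add_sin_sq α) (Real.cos_sq_add_sin_sq β) hn hpx hpy (by
      intro x' y' z' h
      have h' := hm !₂[x', y', z'] ((aux_norm _).2 (by simpa using h))
      rw [hJ, (aux_J _ _ _ _ a b c _ hae hbe hce).2.2.2] at h'
      simpa using h')
  have hc : 0 < Real.cos α := hs.trans hsc
  rw [ia, ib, ic]
  exact ⟨hz, by positivity, hv, by positivity⟩
end

section
/- Let α, β be real numbers with π/6 ≤ α < π/4 and 0 < β < π/2, and set a = (cos α, sin α, 0), b = (cos α, -sin α, 0), c = (cos β, 0, sin β) in ℝ³; assume cos α · cos β < cos 2α. Let p = (p_x, p_y, p_z) be a unit vector that is a minimizer for (a,b,c) with p_x ≥ 0, p_y ≥ 0 and p ≠ a. Then p_x · sin α - p_y · cos α > 0. -/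
open RealInnerProductSpace

lemma sqrt_deriv_aux (B s : ℝ) (hB : B ^ 2 < 1) :
    HasDerivAt (fun t : ℝ => Real.sqrt (1 - (Real.cos t * B + Real.sin t * s) ^ 2))
      (-(B * s) / Real.sqrt (1 - B ^ 2)) 0 := by
  have h1 : HasDerivAt (fun t : ℝ => Real.cos t * B + Real.sin t * s)
      (-Real.sin 0 * B + Real.cos 0 * s) 0 :=
    ((Real.hasDerivAt_cos 0).mul_const B).add ((Real.hasDerivAt_sin 0).mul_const s)
  have h2 := (h1.pow 2).const_sub 1
  have h3 := h2.sqrt (by simp; nlinarith)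
  have hpos : 0 < Real.sqrt (1 - B ^ 2) := Real.sqrt_pos.mpr (by linarith)
  refine h3.congr_deriv ?_
  simp [Pi.pow_apply]
  field_simp

noncomputable def jf (ca sa cb sb x y z : ℝ) : ℝ :=
  Real.sqrt (1 - (ca * x + sa * y) ^ 2) + Real.sqrt (1 - (ca * x - sa * y) ^ 2)
    + Real.sqrt (1 - (cb * x + sb * z) ^ 2)

lemma core_pos (ca sa cb sb x y z : ℝ) (hca : 0 < ca) (hsa : 0 < sa) (hcb : 0 < cb) (hsb : 0 < sb)
    (h1 : ca ^ 2 + sa ^ 2 = 1) (h2 : cb ^ 2 + sb ^ 2 = 1) (hlt : sa < ca)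
    (hx : 0 ≤ x) (hy : 0 ≤ y) (hz : 0 ≤ z) (hs : x ^ 2 + y ^ 2 + z ^ 2 = 1)
    (H : ∀ u v w : ℝ, u ^ 2 + v ^ 2 + w ^ 2 = 1 → jf ca sa cb sb x y z ≤ jf ca sa cb sb u v w)
    (hm : 0 ≤ y * ca - x * sa) : z = 0 ∧ y * ca - x * sa = 0 := by
  have hd : 0 < ca ^ 2 - sa ^ 2 := by nlinarith
  rcases hy.eq_or_lt with rfl | hy
  · exfalso
    have hx0 : x = 0 := by nlinarith
    subst hx0
    have hz1 : z = 1 := by nlinarith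
    subst hz1
    have := H cb 0 sb (by linarith)
    unfold jf at this
    have e1 : cb * cb + sb * sb = 1 := by nlinarith
    have e2 : Real.sqrt (1 - (ca * cb) ^ 2) < 1 := by
      rw [Real.sqrt_lt' one_pos]
      have := mul_pos hca hcb
      nlinarith
    simp [e1] at this
    have := Real.sqrt_nonneg (1 - sb ^ 2)
    linarith
  have hA : 0 < ca * x + sa * y := by positivity
  have hC : 0 ≤ cb * x + sb * z := by positivity
  rcases hm.eq_or_lt with hm0 | hm
  · refine ⟨?_, hm0.symm⟩
    by_contra hz0
    have hz : 0 < z := lt_of_le_of_ne hz (Ne.symm hz0)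
    exfalso
    have hxp : 0 < x := by
      have : 0 < x * sa := by nlinarith [mul_pos hy hca]
      exact pos_of_mul_pos_left this hsa.le
    have hB : 0 < ca * x - sa * y := by
      have : 0 < ca * (ca * x - sa * y) := by
        have : ca * (ca * x - sa * y) = x * (ca ^ 2 - sa ^ 2) := by
          linear_combination (-sa) * (-hm0)
        rw [this]; positivity
      exact pos_of_mul_pos_right this hca.le
    have hz2 : 0 < z ^ 2 := by positivity
    have qA : (ca * x + sa * y) ^ 2 < 1 := by
      have : (x^2+y^2) = (ca * x + sa * y) ^ 2 + (y * ca - x * sa)^2 := by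
        linear_combination (-(x^2+y^2)) * h1
      nlinarith [sq_nonneg (y * ca - x * sa)]
    have qB : (ca * x - sa * y) ^ 2 < 1 := by
      have : (x^2+y^2) = (ca * x - sa * y) ^ 2 + (y * ca + x * sa)^2 := by
        linear_combination (-(x^2+y^2)) * h1
      nlinarith [sq_nonneg (y * ca + x * sa)]
    have qC : (cb * x + sb * z) ^ 2 < 1 := by
      have : (x^2+z^2) = (cb * x + sb * z) ^ 2 + (z * cb - x * sb)^2 := by
        linear_combination (-(x^2+z^2)) * h2
      nlinarith [sq_nonneg (z * cb - x * sb), mul_pos hy hy]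
    have D := ((sqrt_deriv_aux _ 0 qA).add (sqrt_deriv_aux _ (2 * sa * ca) qB)).add
      (sqrt_deriv_aux _ (cb * sa) qC)
    have hmin : IsLocalMin ((fun t : ℝ => Real.sqrt (1 - (Real.cos t * (ca * x + sa * y) + Real.sin t * 0) ^ 2)) + (fun t : ℝ => Real.sqrt (1 - (Real.cos t * (ca * x - sa * y) + Real.sin t * (2 * sa * ca)) ^ 2)) + (fun t : ℝ => Real.sqrt (1 - (Real.cos t * (cb * x + sb * z) + Real.sin t * (cb * sa)) ^ 2))) 0 := by
      refine Filter.Eventually.of_forall fun t => ?_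
      have := H (Real.cos t * x + Real.sin t * sa) (Real.cos t * y - Real.sin t * ca)
        (Real.cos t * z) (by
          linear_combination (Real.cos t)^2 * hs + (Real.sin t)^2 * h1
            + Real.sin_sq_add_cos_sq t + 2 * Real.cos t * Real.sin t * hm0)
      unfold jf at this
      simp only [Pi.add_apply, Real.cos_zero, Real.sin_zero]
      have r1 : Real.cos t * (ca * x + sa * y) + Real.sin t * 0 = ca * (Real.cos t * x + Real.sin t * sa) + sa * (Real.cos t * y - Real.sin t * ca) := by ring
      have r2 : Real.cos t * (ca * x - sa * y) + Real.sin t * (2 * sa * ca) = ca * (Real.cos t * x + Real.sin t * sa) - sa * (Real.cos t * y - Real.sin t * ca) := by ring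
      have r3 : Real.cos t * (cb * x + sb * z) + Real.sin t * (cb * sa) = cb * (Real.cos t * x + Real.sin t * sa) + sb * (Real.cos t * z) := by ring
      rw [r1, r2, r3]
      simpa only [one_mul, zero_mul, add_zero] using this
    have hz := hmin.hasDerivAt_eq_zero D
    have sB : 0 < Real.sqrt (1 - (ca * x - sa * y) ^ 2) := Real.sqrt_pos.mpr (by linarith)
    have sC : 0 < Real.sqrt (1 - (cb * x + sb * z) ^ 2) := Real.sqrt_pos.mpr (by linarith)
    have t1 : 0 < (ca * x - sa * y) * (2 * sa * ca) / Real.sqrt (1 - (ca * x - sa * y) ^ 2) := by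
      positivity
    have t2 : 0 < (cb * x + sb * z) * (cb * sa) / Real.sqrt (1 - (cb * x + sb * z) ^ 2) := by
      positivity
    simp only [neg_div, mul_zero, zero_div, neg_zero] at hz
    linarith
  · exfalso
    set m := y * ca - x * sa with hmdef
    have hu : (x + 2 * m * sa) ^ 2 + (y - 2 * m * ca) ^ 2 + z ^ 2 = 1 := by
      linear_combination hs + 4 * m ^ 2 * h1 + 4 * m * hmdef
    have := H (x + 2 * m * sa) (y - 2 * m * ca) z hu
    unfold jf at this
    have e1 : ca * (x + 2 * m * sa) + sa * (y - 2 * m * ca) = ca * x + sa * y := by ring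
    have e2 : (ca * (x + 2 * m * sa) - sa * (y - 2 * m * ca)) ^ 2 - (ca * x - sa * y) ^ 2
        = 4 * m * (2 * sa * ca) * (ca ^ 2 - sa ^ 2) * (ca * x + sa * y) := by
      have : ca * x - sa * y = (ca ^ 2 - sa ^ 2) * (ca * x + sa * y) - 2 * sa * ca * m := by
        rw [hmdef]
        linear_combination (-(ca * x - sa * y)) * h1
      have e : ca * (x + 2 * m * sa) - sa * (y - 2 * m * ca)
        = (ca * x - sa * y) + 4 * m * sa * ca := by ring
      rw [e, this]; ring
    have e2p : 0 < 4 * m * (2 * sa * ca) * (ca ^ 2 - sa ^ 2) * (ca * x + sa * y) := by positivity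
    have e3 : (cb * x + sb * z) ^ 2 ≤ (cb * (x + 2 * m * sa) + sb * z) ^ 2 := by
      apply pow_le_pow_left₀ hC
      have : 0 ≤ cb * (2 * m * sa) := by positivity
      linarith
    have qB : (ca * (x + 2 * m * sa) - sa * (y - 2 * m * ca)) ^ 2 ≤ 1 := by
      generalize x + 2 * m * sa = u at *
      generalize y - 2 * m * ca = v at *
      have : (u^2+v^2) = (ca * u - sa * v) ^ 2 + (v * ca + u * sa)^2 := by
        linear_combination (-(u^2+v^2)) * h1
      nlinarith [sq_nonneg (v * ca + u * sa), sq_nonneg z]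
    rw [e1] at this
    have l1 : Real.sqrt (1 - (ca * (x + 2 * m * sa) - sa * (y - 2 * m * ca)) ^ 2)
        < Real.sqrt (1 - (ca * x - sa * y) ^ 2) :=
      Real.sqrt_lt_sqrt (by linarith) (by linarith)
    have l2 : Real.sqrt (1 - (cb * (x + 2 * m * sa) + sb * z) ^ 2)
        ≤ Real.sqrt (1 - (cb * x + sb * z) ^ 2) :=
      Real.sqrt_le_sqrt (by linarith)
    linarith

theorem stmt17 (α β : ℝ)
    (hα1 : Real.pi / 6 ≤ α) (hα2 : α < Real.pi / 4)
    (hβ1 : 0 < β) (hβ2 : β < Real.pi / 2)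
    (a b c : EuclideanSpace ℝ (Fin 3))
    (hae : a = ![Real.cos α, Real.sin α, 0])
    (hbe : b = ![Real.cos α, -Real.sin α, 0])
    (hce : c = ![Real.cos β, 0, Real.sin β])
    (hangle : Real.cos α * Real.cos β < Real.cos (2 * α))
    (p : EuclideanSpace ℝ (Fin 3))
    (hp : IsMinimizer a b c p)
    (hpx : 0 ≤ p 0) (hpy : 0 ≤ p 1) (hpa : p ≠ a) :
    0 < p 0 * Real.sin α - p 1 * Real.cos α := by
  have hpi := Real.pi_pos
  have hca : 0 < Real.cos α := Real.cos_pos_of_mem_Ioo ⟨by linarith, by linarith⟩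
  have hsa : 0 < Real.sin α := Real.sin_pos_of_pos_of_lt_pi (by linarith) (by linarith)
  have hcb : 0 < Real.cos β := Real.cos_pos_of_mem_Ioo ⟨by linarith, by linarith⟩
  have hsb : 0 < Real.sin β := Real.sin_pos_of_pos_of_lt_pi (by linarith) (by linarith)
  have hlt : Real.sin α < Real.cos α := by
    have h2 : 0 < Real.cos (2 * α) := lt_trans (mul_pos hca hcb) hangle
    rw [Real.cos_two_mul'] at h2
    nlinarith
  have hJ : ∀ q : EuclideanSpace ℝ (Fin 3), J a b c q
      = jf (Real.cos α) (Real.sin α) (Real.cos β) (Real.sin β) (q 0) (q 1) (q 2) := by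
    intro q
    simp only [J, dS, jf, PiLp.inner_apply, Fin.sum_univ_three, hae, hbe, hce]
    simp
    congr 3 <;> ring_nf
  have hn : ∀ q : EuclideanSpace ℝ (Fin 3), ‖q‖ = 1 ↔ q 0 ^ 2 + q 1 ^ 2 + q 2 ^ 2 = 1 := by
    intro q
    rw [EuclideanSpace.norm_eq, Real.sqrt_eq_one]
    simp [Fin.sum_univ_three]
  obtain ⟨hp1, hp2⟩ := hp
  rw [hn] at hp1
  by_contra hcon
  have H : ∀ u v w : ℝ, u ^ 2 + v ^ 2 + w ^ 2 = 1 →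
      jf (Real.cos α) (Real.sin α) (Real.cos β) (Real.sin β) (p 0) (p 1) (p 2) ≤
      jf (Real.cos α) (Real.sin α) (Real.cos β) (Real.sin β) u v w := by
    intro u v w h
    have := hp2 !₂[u, v, w] ((hn _).mpr (by simpa using h))
    rw [hJ, hJ] at this
    simpa using this
  have hle : jf (Real.cos α) (Real.sin α) (Real.cos β) (Real.sin β) (p 0) (p 1) |p 2| ≤
      jf (Real.cos α) (Real.sin α) (Real.cos β) (Real.sin β) (p 0) (p 1) (p 2) := by
    unfold jf
    refine add_le_add le_rfl (Real.sqrt_le_sqrt (sub_le_sub_left ?_ _))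
    rw [sq_le_sq]
    have h0 : 0 ≤ Real.cos β * p 0 := by positivity
    rw [abs_of_nonneg (a := _ + Real.sin β * |p 2|) (by positivity)]
    calc _ ≤ |Real.cos β * p 0| + |Real.sin β * p 2| := abs_add_le _ _
      _ = _ := by rw [abs_of_nonneg h0, abs_mul, abs_of_pos hsb]
  obtain ⟨hz, hm⟩ := core_pos _ _ _ _ (p 0) (p 1) |p 2| hca hsa hcb hsb
    (by linarith [Real.sin_sq_add_cos_sq α]) (by linarith [Real.sin_sq_add_cos_sq β]) hlt hpx hpy
    (abs_nonneg _) (by rw [sq_abs]; exact hp1) (fun u v w h => hle.trans (H u v w h))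
    (by linarith)
  have hz : p 2 = 0 := abs_eq_zero.mp hz
  have hsc := Real.sin_sq_add_cos_sq α
  rw [hz] at hp1
  have hr : p 0 * Real.cos α + p 1 * Real.sin α = 1 := by
    have h0 : 0 ≤ p 0 * Real.cos α + p 1 * Real.sin α := by positivity
    have : (p 0 * Real.cos α + p 1 * Real.sin α) ^ 2 = 1 := by
      linear_combination hp1 + (p 0 ^ 2 + p 1 ^ 2) * hsc
        - (p 1 * Real.cos α - p 0 * Real.sin α) * hm
    nlinarith
  have hx : p 0 = Real.cos α := by
    linear_combination Real.cos α * hr - Real.sin α * hm - p 0 * hsc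
  have hy : p 1 = Real.sin α := by
    linear_combination Real.sin α * hr + Real.cos α * hm - p 1 * hsc
  apply hpa
  ext i
  fin_cases i <;> simp [hae, hx, hy, hz]
end

section
/- Let φ₁, φ₂ be real numbers with π/3 ≤ φ₁ ≤ φ₂ < π/2 and let a, b, c be linearly independent unit vectors in ℝ³ with ⟪a,b⟫ = cos φ₁ and ⟪a,c⟫ = ⟪b,c⟫ = cos φ₂. Let d = (c - ⟪a,c⟫ • a) / ‖c - ⟪a,c⟫ • a‖, so that {a, d} is an orthonormal basis of the plane spanned by a and c. Then ⟪a,b⟫² + ⟪d,b⟫² < 1/2; that is, the squared norm of the orthogonal projection of b onto the plane spanned by a and c is less than 1/2 (equivalently, the angle χ of b from that plane satisfies cos²χ < 1/2). -/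
open RealInnerProductSpace

theorem stmt18 (φ₁ φ₂ : ℝ)
    (hφ1 : Real.pi / 3 ≤ φ₁) (hφ12 : φ₁ ≤ φ₂) (hφ2 : φ₂ < Real.pi / 2)
    (a b c : EuclideanSpace ℝ (Fin 3))
    (ha : ‖a‖ = 1) (hb : ‖b‖ = 1) (hc : ‖c‖ = 1)
    (hli : LinearIndependent ℝ ![a, b, c])
    (hab : ⟪a, b⟫ = Real.cos φ₁) (hac : ⟪a, c⟫ = Real.cos φ₂) (hbc : ⟪b, c⟫ = Real.cos φ₂)
    (d : EuclideanSpace ℝ (Fin 3))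
    (hd : d = ‖c - ⟪a, c⟫ • a‖⁻¹ • (c - ⟪a, c⟫ • a)) :
    ⟪a, b⟫ ^ 2 + ⟪d, b⟫ ^ 2 < 1 / 2 := by
  have hy0 : 0 < Real.cos φ₂ :=
    Real.cos_pos_of_mem_Ioo ⟨by linarith [Real.pi_pos], hφ2⟩
  have hyx : Real.cos φ₂ ≤ Real.cos φ₁ :=
    Real.cos_le_cos_of_nonneg_of_le_pi (by linarith [Real.pi_pos]) (by linarith [Real.pi_pos]) hφ12
  have hx : Real.cos φ₁ ≤ 1 / 2 := by
    rw [← Real.cos_pi_div_three]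
    exact Real.cos_le_cos_of_nonneg_of_le_pi (by linarith [Real.pi_pos])
      (by linarith [Real.pi_pos]) hφ1
  have hn : ‖c - ⟪a, c⟫ • a‖ ^ 2 = 1 - Real.cos φ₂ ^ 2 := by
    rw [norm_sub_sq_real, inner_smul_right, norm_smul, real_inner_comm a c, hac, ha, hc,
      Real.norm_eq_abs, mul_one, sq_abs]
    ring
  have hdb : ⟪d, b⟫ = ‖c - ⟪a, c⟫ • a‖⁻¹ * (Real.cos φ₂ - Real.cos φ₂ * Real.cos φ₁) := by
    rw [hd, real_inner_smul_left, inner_sub_left, real_inner_smul_left, real_inner_comm b c,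
      hbc, hab, hac]
  rw [hdb, hab, mul_pow, inv_pow, hn]
  generalize Real.cos φ₁ = x at *
  generalize Real.cos φ₂ = y at *
  have hpos : 0 < 1 - y ^ 2 := by nlinarith
  have hyy : y ^ 2 ≤ x ^ 2 := by nlinarith
  have hxx : x ^ 2 ≤ 1 / 4 := by nlinarith
  have h1 : y ^ 2 * (3 / 2 - 2 * x) ≤ x ^ 2 * (3 / 2 - 2 * x) :=
    mul_le_mul_of_nonneg_right hyy (by linarith)
  have h2 : x * (3 / 2 - 2 * x) ≤ 9 / 32 := by nlinarith [sq_nonneg (x - 3 / 8)]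
  have h3 : x ^ 2 * (3 / 2 - 2 * x) ≤ 9 / 64 := by
    nlinarith [mul_le_mul_of_nonneg_left h2 (by linarith : (0 : ℝ) ≤ x)]
  have key : (y - y * x) ^ 2 < (1 / 2 - x ^ 2) * (1 - y ^ 2) := by nlinarith
  have := (div_lt_iff₀ hpos).2 key
  rw [div_eq_inv_mul] at this
  linarith
end

section
/- Let φ₁, φ₂, φ₃ be real numbers with π/3 ≤ φ₁ ≤ φ₂ < φ₃ < π/2. Define α = arccos((cos φ₃ - cos φ₁ · cos φ₂)/(sin φ₁ · sin φ₂)) and α' = arccos((cos φ₂ - cos φ₁ · cos φ₂)/(sin φ₁ · sin φ₂)). Then α/2 < α' < α. -/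
theorem stmt19 (φ₁ φ₂ φ₃ : ℝ)
    (h1 : Real.pi / 3 ≤ φ₁) (h12 : φ₁ ≤ φ₂) (h23 : φ₂ < φ₃) (h3 : φ₃ < Real.pi / 2)
    (α α' : ℝ)
    (hα : α = Real.arccos ((Real.cos φ₃ - Real.cos φ₁ * Real.cos φ₂) / (Real.sin φ₁ * Real.sin φ₂)))
    (hα' : α' = Real.arccos ((Real.cos φ₂ - Real.cos φ₁ * Real.cos φ₂) / (Real.sin φ₁ * Real.sin φ₂))) :
    α / 2 < α' ∧ α' < α := by
  have hpi := Real.pi_pos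
  have hx : Real.cos φ₁ ≤ 1 / 2 := by
    rw [← Real.cos_pi_div_three]
    exact Real.cos_le_cos_of_nonneg_of_le_pi (by linarith) (by linarith) h1
  have hyx : Real.cos φ₂ ≤ Real.cos φ₁ :=
    Real.cos_le_cos_of_nonneg_of_le_pi (by linarith) (by linarith) h12
  have hzy : Real.cos φ₃ < Real.cos φ₂ :=
    Real.cos_lt_cos_of_nonneg_of_le_pi (by linarith) (by linarith) h23
  have hz : 0 < Real.cos φ₃ := Real.cos_pos_of_mem_Ioo ⟨by linarith, h3⟩
  have hs1 : 0 < Real.sin φ₁ := Real.sin_pos_of_pos_of_lt_pi (by linarith) (by linarith)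
  have hs2 : 0 < Real.sin φ₂ := Real.sin_pos_of_pos_of_lt_pi (by linarith) (by linarith)
  have e1 := Real.sin_sq_add_cos_sq φ₁
  have e2 := Real.sin_sq_add_cos_sq φ₂
  have hs : 3 / 4 ≤ Real.sin φ₁ * Real.sin φ₂ := by
    have a1 : 3 / 4 ≤ Real.sin φ₁ ^ 2 := by nlinarith
    have a2 : 3 / 4 ≤ Real.sin φ₂ ^ 2 := by nlinarith
    refine (sq_le_sq₀ (by norm_num) (by positivity)).1 ?_
    rw [mul_pow]
    nlinarith
  generalize Real.sin φ₁ * Real.sin φ₂ = s at *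
  generalize Real.cos φ₁ = x at *
  generalize Real.cos φ₂ = y at *
  generalize Real.cos φ₃ = z at *
  have hs0 : 0 < s := by linarith
  have huv : (z - x * y) / s < (y - x * y) / s := by gcongr
  have hv0 : 0 ≤ (y - x * y) / s := div_nonneg (by nlinarith) hs0.le
  have hv1 : (y - x * y) / s ≤ 1 / 3 := by
    rw [div_le_iff₀ hs0]; nlinarith
  have hu : -(1 / 3) ≤ (z - x * y) / s := by
    rw [le_div_iff₀ hs0]; nlinarith
  generalize (z - x * y) / s = u at *
  generalize (y - x * y) / s = v at *
  subst hα hα'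
  refine ⟨?_, Real.arccos_lt_arccos (by linarith) huv (by linarith)⟩
  by_contra! h
  have hc := Real.cos_le_cos_of_nonneg_of_le_pi (x := 2 * Real.arccos v) (y := Real.arccos u)
    (by linarith [Real.arccos_nonneg v]) (Real.arccos_le_pi u) (by linarith)
  rw [Real.cos_two_mul, Real.cos_arccos (by linarith) (by linarith),
    Real.cos_arccos (by linarith) (by linarith)] at hc
  nlinarith
end
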